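/- Fix parameters ν₀ > 0, ε > 0, p ∈ (1, 2], γ ∈ {0, 1}, a measurable set Ω ⊆ ℝ^d, a differentiable vector field u^k : ℝ^d → ℝ^d, and a constant c₀ > 0. Let q : Ω → ℝ be square-integrable and suppose v : ℝ^d → ℝ^d is a differentiable vector field satisfying the inf-sup inequality (∫_Ω q (div v) dx)² ≥ c₀² (∫_Ω |∇v|² dx)(∫_Ω q² dx). Then (∫_Ω q (div v) dx)² ≥ (c₀² / (ν₀ ε^{p-2})) · a'(u^k)(v, v) · ∫_Ω q² dx, assuming all integrands appearing are integrable on Ω. -/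

import Mathlib

open MeasureTheory Matrix

noncomputable def jac {d : ℕ} (u : (Fin d → ℝ) → (Fin d → ℝ)) (x : Fin d → ℝ) :
    Matrix (Fin d) (Fin d) ℝ :=
  fun i j => fderiv ℝ u x (Pi.single j 1) i

noncomputable def strain {d : ℕ} (u : (Fin d → ℝ) → (Fin d → ℝ)) (x : Fin d → ℝ) :
    Matrix (Fin d) (Fin d) ℝ :=
  fun i j => (jac u x i j + jac u x j i) / 2

noncomputable def divg {d : ℕ} (u : (Fin d → ℝ) → (Fin d → ℝ)) (x : Fin d → ℝ) : ℝ :=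
  ∑ i, jac u x i i

def frob {d : ℕ} (A B : Matrix (Fin d) (Fin d) ℝ) : ℝ := ∑ i, ∑ j, A i j * B i j

/-- The linearized viscous form a'(u^k)(v, v). -/
noncomputable def aform {d : ℕ} (ν₀ ε p γ : ℝ) (Ω : Set (Fin d → ℝ))
    (uk v : (Fin d → ℝ) → (Fin d → ℝ)) : ℝ :=
  ∫ x in Ω,
    (ν₀ * (ε ^ 2 + frob (strain uk x) (strain uk x)) ^ ((p - 2) / 2) *
        frob (strain v x) (strain v x)
      + γ * (p - 2) * ν₀ *
          (ε ^ 2 + frob (strain uk x) (strain uk x)) ^ ((p - 4) / 2) *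
          (frob (strain uk x) (strain v x)) ^ 2)

theorem frob_self_nonneg {d : ℕ} (A : Matrix (Fin d) (Fin d) ℝ) : 0 ≤ frob A A :=
  Finset.sum_nonneg fun _ _ => Finset.sum_nonneg fun _ _ => mul_self_nonneg _

theorem frob_strain_le_frob_jac {d : ℕ} (u : (Fin d → ℝ) → (Fin d → ℝ)) (x : Fin d → ℝ) :
    frob (strain u x) (strain u x) ≤ frob (jac u x) (jac u x) := by
  have hswap : ∑ i, ∑ j, jac u x j i * jac u x j i = frob (jac u x) (jac u x) :=
    Finset.sum_comm
  calc frob (strain u x) (strain u x)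
      ≤ ∑ i, ∑ j, ((jac u x i j * jac u x i j) / 2 + (jac u x j i * jac u x j i) / 2) := by
        refine Finset.sum_le_sum fun i _ => Finset.sum_le_sum fun j _ => ?_
        simp only [strain]
        nlinarith [sq_nonneg (jac u x i j - jac u x j i)]
    _ = frob (jac u x) (jac u x) := by
        simp only [Finset.sum_add_distrib, ← Finset.sum_div, hswap]
        exact add_halves _

/-- For shear-thinning exponents `p ≤ 2` the regularized viscosity is largest at zero strain. -/
theorem rpow_sq_add_le {ε p s : ℝ} (hε : 0 < ε) (hp : p ≤ 2) (hs : 0 ≤ s) :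
    (ε ^ 2 + s) ^ ((p - 2) / 2) ≤ ε ^ (p - 2) := by
  calc (ε ^ 2 + s) ^ ((p - 2) / 2) ≤ (ε ^ 2) ^ ((p - 2) / 2) :=
        Real.rpow_le_rpow_of_nonpos (by positivity) (by linarith) (by linarith)
    _ = ε ^ (p - 2) := by
        rw [← Real.rpow_natCast, ← Real.rpow_mul hε.le]
        congr 1
        push_cast
        ring

/-- The form is bounded by the maximal viscosity times the Dirichlet energy. -/
theorem aform_le {d : ℕ} {ν₀ ε p γ : ℝ} (hν₀ : 0 ≤ ν₀) (hε : 0 < ε) (hp : p ≤ 2) (hγ : 0 ≤ γ)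
    {Ω : Set (Fin d → ℝ)} {uk v : (Fin d → ℝ) → (Fin d → ℝ)}
    (hgradv : IntegrableOn (fun x => frob (jac v x) (jac v x)) Ω)
    (haint : IntegrableOn (fun x =>
      ν₀ * (ε ^ 2 + frob (strain uk x) (strain uk x)) ^ ((p - 2) / 2) *
          frob (strain v x) (strain v x)
        + γ * (p - 2) * ν₀ *
            (ε ^ 2 + frob (strain uk x) (strain uk x)) ^ ((p - 4) / 2) *
            (frob (strain uk x) (strain v x)) ^ 2) Ω) :
    aform ν₀ ε p γ Ω uk v ≤
      ν₀ * ε ^ (p - 2) * ∫ x in Ω, frob (jac v x) (jac v x) := by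
  rw [← integral_const_mul]
  refine integral_mono haint (hgradv.const_mul _) fun x => ?_
  have hs := frob_self_nonneg (strain uk x)
  have hmain : ν₀ * (ε ^ 2 + frob (strain uk x) (strain uk x)) ^ ((p - 2) / 2) *
      frob (strain v x) (strain v x) ≤ ν₀ * ε ^ (p - 2) * frob (jac v x) (jac v x) :=
    mul_le_mul (mul_le_mul_of_nonneg_left (rpow_sq_add_le hε hp hs) hν₀)
      (frob_strain_le_frob_jac v x) (frob_self_nonneg _) (by positivity)
  have hcorr : γ * (p - 2) * ν₀ *
      (ε ^ 2 + frob (strain uk x) (strain uk x)) ^ ((p - 4) / 2) *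
      (frob (strain uk x) (strain v x)) ^ 2 ≤ 0 :=
    mul_nonpos_of_nonpos_of_nonneg
      (mul_nonpos_of_nonpos_of_nonneg
        (mul_nonpos_of_nonpos_of_nonneg
          (mul_nonpos_of_nonneg_of_nonpos hγ (by linarith)) hν₀) (by positivity))
      (sq_nonneg _)
  exact (add_le_add hmain hcorr).trans_eq (add_zero _)

/-- Lower bound of Proposition 4.3(i): the LBB inf-sup inequality
yields the lower eigenvalue bound `c₀² ε^(2-p)/ν₀ = c₀² / ν_max` for the
mass-matrix preconditioned Schur complement. -/
theorem schur_lower_bound_mass_matrix {d : ℕ} (ν₀ ε p γ : ℝ)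
    (hν₀ : 0 < ν₀) (hε : 0 < ε) (hp1 : 1 < p) (hp2 : p ≤ 2)
    (hγ : γ = 0 ∨ γ = 1)
    (Ω : Set (Fin d → ℝ)) (hΩ : MeasurableSet Ω)
    (uk : (Fin d → ℝ) → (Fin d → ℝ)) (huk : Differentiable ℝ uk)
    (c₀ : ℝ) (hc₀ : 0 < c₀)
    (q : (Fin d → ℝ) → ℝ)
    (hq2 : IntegrableOn (fun x => (q x) ^ 2) Ω)
    (v : (Fin d → ℝ) → (Fin d → ℝ)) (hv : Differentiable ℝ v)
    (hqdiv : IntegrableOn (fun x => q x * divg v x) Ω)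
    (hgradv : IntegrableOn (fun x => frob (jac v x) (jac v x)) Ω)
    (hDv2 : IntegrableOn (fun x => frob (strain v x) (strain v x)) Ω)
    (haint : IntegrableOn (fun x =>
      ν₀ * (ε ^ 2 + frob (strain uk x) (strain uk x)) ^ ((p - 2) / 2) *
          frob (strain v x) (strain v x)
        + γ * (p - 2) * ν₀ *
            (ε ^ 2 + frob (strain uk x) (strain uk x)) ^ ((p - 4) / 2) *
            (frob (strain uk x) (strain v x)) ^ 2) Ω)
    (hinfsup : (∫ x in Ω, q x * divg v x) ^ 2 ≥
      c₀ ^ 2 * ((∫ x in Ω, frob (jac v x) (jac v x)) * ∫ x in Ω, (q x) ^ 2)) :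
    (∫ x in Ω, q x * divg v x) ^ 2 ≥
      (c₀ ^ 2 / (ν₀ * ε ^ (p - 2))) * aform ν₀ ε p γ Ω uk v *
        ∫ x in Ω, (q x) ^ 2 := by
  have hγ0 : 0 ≤ γ := by rcases hγ with rfl | rfl <;> norm_num
  have hν : 0 < ν₀ * ε ^ (p - 2) := by positivity
  have hq : 0 ≤ ∫ x in Ω, (q x) ^ 2 := integral_nonneg fun x => sq_nonneg _
  refine le_trans ?_ hinfsup
  rw [← mul_assoc]
  refine mul_le_mul_of_nonneg_right ?_ hq
  rw [div_mul_eq_mul_div, mul_div_assoc]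
  refine mul_le_mul_of_nonneg_left ?_ (sq_nonneg c₀)
  rw [div_le_iff₀' hν]
  exact aform_le hν₀.le hε hp2 hγ0 hgradv haint
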